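/- For every g ∈ S(ℝ^m)_{m|2n}: F^±_{m|2n}(Δg)(y) = −y² · F^±_{m|2n}(g)(y) and F^±_{m|2n}(x² · g)(y) = −Δ_y F^±_{m|2n}(g)(y), where y² denotes multiplication by the element Σ_{j=1}^n y`_{2j−1} y`_{2j} − Σ_{j=1}^m y_j², x² denotes multiplication by Σ_{j=1}^n x`_{2j−1} x`_{2j} − Σ_{j=1}^m x_j², and Δ_y is the super Laplace operator in the y variables. -/

import Mathlib

open scoped BigOperators
open Finset MeasureTheory

noncomputable section

/-- The Grassmann algebra on `N` anticommuting generators with coefficients in a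
commutative ring `R`, represented by its coefficients with respect to the basis of
increasingly-ordered monomials, indexed by subsets of the generators. -/
abbrev Gr (R : Type) (N : ℕ) : Type := Finset (Fin N) → R

namespace Gr

variable {R : Type} [CommRing R] {N : ℕ}

/-- The sign produced when reordering the concatenation of the ordered monomials indexed
by `A` and `B` into the ordered monomial indexed by `A ∪ B`. -/
def msign (A B : Finset (Fin N)) : R :=
  (-1 : R) ^ (((A ×ˢ B).filter fun p => p.2 < p.1).card)

/-- Multiplication of the Grassmann algebra. -/
def mul (f g : Gr R N) : Gr R N :=
  fun s => ∑ A ∈ s.powerset, msign A (s \ A) * f A * g (s \ A)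

/-- The unit of the Grassmann algebra. -/
def one : Gr R N := fun s => if s = (∅ : Finset (Fin N)) then 1 else 0

/-- The `j`-th generator of the Grassmann algebra. -/
def gen (j : Fin N) : Gr R N := fun s => if s = {j} then 1 else 0

/-- Powers in the Grassmann algebra. -/
def pow (f : Gr R N) : ℕ → Gr R N
  | 0 => one
  | k + 1 => mul (pow f k) f

/-- The left partial derivative `∂_j`, i.e. the odd derivation with `∂_j(x_k) = δ_{jk}`. -/
def pderiv (j : Fin N) (f : Gr R N) : Gr R N :=
  fun s => if j ∈ s then 0
    else (-1 : R) ^ ((s.filter fun i => i < j).card) * f (insert j s)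

/-- The exponential of a Grassmann algebra element with nilpotent (zero-constant-term)
argument: the series terminates, and all terms beyond degree `N` vanish. -/
def gexp (f : Gr ℂ N) : Gr ℂ N :=
  ∑ k ∈ Finset.range (N + 1), ((k.factorial : ℂ))⁻¹ • pow f k

/-- Iterated left partial derivatives: the first element of the list acts first. -/
def derivList (l : List (Fin N)) (f : Gr R N) : Gr R N :=
  l.foldl (fun g j => pderiv j g) f

/-- Complex conjugation of the coefficients. -/
def gconj (f : Gr ℂ N) : Gr ℂ N := fun s => (starRingEnd ℂ) (f s)

end Gr

/-- The Lean index of the paper's generator `x`_{2j-1}` (j = 1,…,n). -/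
def lo (n : ℕ) (j : Fin n) : Fin (2 * n) := ⟨2 * (j : ℕ), by have := j.isLt; omega⟩

/-- The Lean index of the paper's generator `x`_{2j}` (j = 1,…,n). -/
def hi (n : ℕ) (j : Fin n) : Fin (2 * n) := ⟨2 * (j : ℕ) + 1, by have := j.isLt; omega⟩

/-- `x`² = Σ_{j=1}^n x`_{2j-1} x`_{2j}`. -/
def xsq (n : ℕ) : Gr ℂ (2 * n) := ∑ j : Fin n, Gr.mul (Gr.gen (lo n j)) (Gr.gen (hi n j))

/-- The fermionic Laplace operator `Δ_f = 4 Σ_{j=1}^n ∂_{x`_{2j-1}} ∂_{x`_{2j}}`. -/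
def lapF (n : ℕ) (f : Gr ℂ (2 * n)) : Gr ℂ (2 * n) :=
  (4 : ℂ) • ∑ j : Fin n, Gr.pderiv (lo n j) (Gr.pderiv (hi n j) f)

/-- The Berezin integral `∫_B = π^{-n} ∂_{x`_{2n}} ⋯ ∂_{x`_1}`. -/
def berezin (n : ℕ) (f : Gr ℂ (2 * n)) : ℂ :=
  ((Real.pi : ℂ) ^ n)⁻¹ * Gr.derivList (List.finRange (2 * n)) f ∅

/-- The fermionic Gaussian `exp(x`²/2) = Σ_{j=0}^n (x`²)^j/(2^j j!)`. -/
def fermGauss (n : ℕ) : Gr ℂ (2 * n) :=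
  ∑ j ∈ Finset.range (n + 1), (((2 : ℂ) ^ j * j.factorial)⁻¹) • Gr.pow (xsq n) j

/-- Embedding of the `x` generators into the Grassmann algebra on the `4n` generators
`x`_1, …, x`_{2n}, y`_1, …, y`_{2n}` (the `x` generators come first). -/
def xi (n : ℕ) (t : Fin (2 * n)) : Fin (2 * n + 2 * n) := Fin.castAdd (2 * n) t

/-- Embedding of the `y` generators into the Grassmann algebra on the `4n` generators. -/
def yi (n : ℕ) (t : Fin (2 * n)) : Fin (2 * n + 2 * n) := Fin.natAdd (2 * n) t

/-- The algebra embedding `Λ_{2n} → Λ_{4n}` sending the generators to the `x` generators. -/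
def embX (n : ℕ) (f : Gr ℂ (2 * n)) : Gr ℂ (2 * n + 2 * n) :=
  fun s => ∑ A : Finset (Fin (2 * n)), if s = A.image (xi n) then f A else 0

/-- The Berezin integral with respect to the `x` variables,
`π^{-n} ∂_{x`_{2n}} ⋯ ∂_{x`_1}`, inside the mixed algebra `Λ_{4n}`. -/
def berezinX (n : ℕ) (F : Gr ℂ (2 * n + 2 * n)) : Gr ℂ (2 * n + 2 * n) :=
  ((Real.pi : ℂ) ^ n)⁻¹ • Gr.derivList ((List.finRange (2 * n)).map (xi n)) F

/-- The fermionic Fourier kernel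
`K^σ(x, y) = exp(-σ (i/2) Σ_{j=1}^n (x`_{2j-1} y`_{2j} - x`_{2j} y`_{2j-1}))`
(for the plus sign `σ = 1`, for the minus sign `σ = -1`). -/
def fermK (n : ℕ) (σ : ℂ) : Gr ℂ (2 * n + 2 * n) :=
  Gr.gexp ((-σ * (Complex.I / 2)) • ∑ j : Fin n,
    (Gr.mul (Gr.gen (xi n (lo n j))) (Gr.gen (yi n (hi n j))) -
     Gr.mul (Gr.gen (xi n (hi n j))) (Gr.gen (yi n (lo n j)))))

/-- The fermionic Fourier transform
`F^σ_{0|2n}(g)(y) = (2π)^n ∫_{B,x} K^σ(x,y) g(x)`, an element of the Grassmann algebra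
in the `y` variables, identified with `Λ_{2n}`. -/
def fermFT (n : ℕ) (σ : ℂ) (g : Gr ℂ (2 * n)) : Gr ℂ (2 * n) :=
  fun s => (((2 * Real.pi : ℝ) : ℂ) ^ n) *
    berezinX n (Gr.mul (fermK n σ) (embX n g)) (s.image (yi n))


end
noncomputable section

/-- Functions on `ℝ^m` with values in the Grassmann algebra `Λ_{2n}`; the elements with
Schwartz coefficients form the space `S(ℝ^m)_{m|2n}`. -/
abbrev SF (m n : ℕ) : Type := ((Fin m) → ℝ) → Gr ℂ (2 * n)

/-- `f ∈ S(ℝ^m)_{m|2n}`: every Grassmann coefficient of `f` is a Schwartz function. -/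
def IsSchwartz (m n : ℕ) (f : SF m n) : Prop :=
  ∀ s : Finset (Fin (2 * n)), ∃ φ : SchwartzMap ((Fin m) → ℝ) ℂ, ∀ x, f x s = φ x

/-- The super Fourier transform
`F^σ_{m|2n}(f)(y) = (2π)^{-M/2} ∫_{ℝ^m} dV(x) ∫_{B,x} exp(σ i Σ_i x_i y_i) K^σ(x,y) f(x)`,
with `M = m - 2n` (plus sign: `σ = 1`; minus sign: `σ = -1`). -/
def superFT (m n : ℕ) (σ : ℂ) (f : SF m n) : SF m n :=
  fun y s => (((2 * Real.pi : ℝ) : ℂ) ^ ((-((m : ℂ) - 2 * (n : ℂ))) / 2)) *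
    ∫ x : (Fin m) → ℝ, Complex.exp (σ * Complex.I * ∑ i, (x i : ℂ) * (y i : ℂ)) *
      berezinX n (Gr.mul (fermK n σ) (embX n (f x))) (s.image (yi n))

/-- The partial derivative `∂_{x_i}` of a `Λ_{2n}`-valued function, acting coefficientwise. -/
def bderiv (m n : ℕ) (i : Fin m) (f : SF m n) : SF m n :=
  fun x s => fderiv ℝ (fun t => f t s) x (Pi.single i 1)

/-- The super Laplace operator `Δ = 4 Σ_j ∂_{x`_{2j-1}} ∂_{x`_{2j}} - Σ_j ∂_{x_j}²`. -/
def superLap (m n : ℕ) (f : SF m n) : SF m n :=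
  fun x => lapF n (f x) - ∑ i : Fin m, bderiv m n i (bderiv m n i f) x

/-- The element `x² = Σ_{j=1}^n x`_{2j-1} x`_{2j} - Σ_{j=1}^m x_j²` at the point `x`. -/
def xsqElem (m n : ℕ) (x : (Fin m) → ℝ) : Gr ℂ (2 * n) :=
  xsq n + (-(∑ i : Fin m, ((x i : ℂ)) ^ 2)) • Gr.one

/-- The super Gaussian `exp(x²/2) = exp(-(x_1²+⋯+x_m²)/2) Σ_{j=0}^n (x`²)^j/(2^j j!)`. -/
def gaussFun (m n : ℕ) : SF m n :=
  fun x => ((Real.exp (-(∑ i : Fin m, (x i) ^ 2) / 2) : ℝ) : ℂ) • fermGauss n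

/-- The Euler operator `𝔼 = Σ_j x_j ∂_{x_j} + Σ_j x`_j ∂_{x`_j}`. -/
def euler (m n : ℕ) (f : SF m n) : SF m n :=
  fun x => (∑ i : Fin m, ((x i : ℂ)) • bderiv m n i f x) +
    ∑ t : Fin (2 * n), Gr.mul (Gr.gen t) (Gr.pderiv t (f x))

/-- The super integral `∫_{ℝ^{m|2n}} f = ∫_{ℝ^m} dV(x) ∫_B f`. -/
def superInt (m n : ℕ) (f : SF m n) : ℂ := ∫ x : (Fin m) → ℝ, berezin n (f x)

end

noncomputable section

namespace Gr

section CommRing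

variable {R : Type} [CommRing R] {N : ℕ}

theorem msign_union_left {A A' : Finset (Fin N)} (h : Disjoint A A') (B : Finset (Fin N)) :
    (msign (A ∪ A') B : R) = msign A B * msign A' B := by
  unfold msign
  rw [← pow_add, union_product, filter_union, card_union_of_disjoint]
  exact disjoint_filter_filter (disjoint_product.mpr (Or.inl h))

theorem msign_union_right (A : Finset (Fin N)) {B B' : Finset (Fin N)} (h : Disjoint B B') :
    (msign A (B ∪ B') : R) = msign A B * msign A B' := by
  unfold msign
  rw [← pow_add, product_union, filter_union, card_union_of_disjoint]
  exact disjoint_filter_filter (disjoint_product.mpr (Or.inr h))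

theorem msign_singleton_left (j : Fin N) (s : Finset (Fin N)) :
    (msign {j} s : R) = (-1) ^ (s.filter fun i => i < j).card := by
  unfold msign
  rw [singleton_product, filter_map, card_map]
  rfl

theorem mul_assoc (f g h : Gr R N) : mul (mul f g) h = mul f (mul g h) := by
  funext s
  simp only [mul, mul_sum, sum_mul]
  rw [sum_sigma', sum_sigma']
  refine sum_bij' (fun p _ => ⟨p.2, p.1 \ p.2⟩) (fun p _ => ⟨p.1 ∪ p.2, p.1⟩) ?_ ?_ ?_ ?_ ?_
  · rintro ⟨A, B⟩ hp
    simp only [mem_sigma, mem_powerset] at hp ⊢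
    exact ⟨hp.2.trans hp.1, sdiff_subset_sdiff hp.1 subset_rfl⟩
  · rintro ⟨B, C⟩ hp
    simp only [mem_sigma, mem_powerset] at hp ⊢
    exact ⟨union_subset hp.1 (hp.2.trans sdiff_subset), subset_union_left⟩
  · rintro ⟨A, B⟩ hp
    simp only [mem_sigma, mem_powerset] at hp
    simp [union_sdiff_of_subset hp.2]
  · rintro ⟨B, C⟩ hp
    simp only [mem_sigma, mem_powerset] at hp
    have hd : Disjoint C B := disjoint_of_subset_left hp.2 sdiff_disjoint
    simp [union_sdiff_cancel_left hd.symm]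
  · rintro ⟨A, B⟩ hp
    simp only [mem_sigma, mem_powerset] at hp ⊢
    obtain ⟨hA, hB⟩ := hp
    have e1 : (s \ B) \ (A \ B) = s \ A := by
      ext i; have := @hB i; simp only [mem_sdiff]; tauto
    have d1 : Disjoint B (A \ B) := disjoint_sdiff
    have d2 : Disjoint (A \ B) (s \ A) :=
      disjoint_of_subset_left sdiff_subset disjoint_sdiff
    have e2 : s \ B = (A \ B) ∪ (s \ A) := by
      ext i; have := @hB i; have := @hA i; simp only [mem_sdiff, mem_union]; tauto
    have e3 : (msign A (s \ A) : R) = msign B (s \ A) * msign (A \ B) (s \ A) := by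
      rw [← msign_union_left d1, union_sdiff_of_subset hB]
    rw [e1, e3, e2, msign_union_right _ d2]
    ring

theorem gen_mul_apply (j : Fin N) (f : Gr R N) (s : Finset (Fin N)) :
    mul (gen j) f s =
      if j ∈ s then (-1) ^ (s.filter fun i => i < j).card * f (s.erase j) else 0 := by
  unfold mul
  split_ifs with h
  · rw [sum_eq_single_of_mem {j} (by simpa using h)]
    · rw [msign_singleton_left, sdiff_singleton_eq_erase, filter_erase,
        erase_eq_of_notMem (by simp)]
      simp [gen]
    · intro A _ hA
      simp [gen, hA]
  · refine sum_eq_zero fun A hA => ?_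
    have : A ≠ {j} := by
      rintro rfl
      exact h (by simpa using hA)
    simp [gen, this]

theorem mul_apply_eq_zero_of_card {f g : Gr R N} {a b : ℕ}
    (hf : ∀ s, s.card ≠ a → f s = 0) (hg : ∀ s, s.card ≠ b → g s = 0)
    (s : Finset (Fin N)) (hs : s.card ≠ a + b) : mul f g s = 0 := by
  refine sum_eq_zero fun A hA => ?_
  have hc := card_sdiff_add_card_eq_card (mem_powerset.mp hA)
  by_cases hA' : A.card = a
  · rw [hg _ (by omega)]; simp
  · rw [hf _ hA']; simp

theorem gen_apply_eq_zero_of_card (j : Fin N) (s : Finset (Fin N)) (hs : s.card ≠ 1) :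
    (gen j : Gr R N) s = 0 := by
  have : s ≠ {j} := by rintro rfl; simp at hs
  simp [gen, this]

theorem pow_apply_eq_zero_of_card {f : Gr R N} {a : ℕ} (hf : ∀ s, s.card ≠ a → f s = 0)
    (k : ℕ) (s : Finset (Fin N)) (hs : s.card ≠ k * a) : pow f k s = 0 := by
  induction k generalizing s with
  | zero =>
    have : s ≠ ∅ := by rintro rfl; simp at hs
    simp [pow, one, this]
  | succ k ih =>
    exact mul_apply_eq_zero_of_card ih hf s (by rwa [← Nat.succ_mul])

theorem one_mul (f : Gr R N) : mul one f = f := by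
  funext s
  unfold mul
  rw [sum_eq_single_of_mem ∅ (by simp)]
  · simp [one, msign]
  · intro A _ hA
    simp [one, hA]

end CommRing

variable {N : ℕ}

/-- Left multiplication in the Grassmann algebra, as a linear endomorphism depending linearly
on the multiplier. -/
def lmul : Gr ℂ N →ₗ[ℂ] Module.End ℂ (Gr ℂ N) :=
  LinearMap.mk₂ ℂ mul
    (fun f f' g => by
      funext s; simp only [mul, Pi.add_apply, ← sum_add_distrib]
      exact sum_congr rfl fun _ _ => by ring)
    (fun c f g => by
      funext s; simp only [mul, Pi.smul_apply, smul_eq_mul, mul_sum]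
      exact sum_congr rfl fun _ _ => by ring)
    (fun f g g' => by
      funext s; simp only [mul, Pi.add_apply, ← sum_add_distrib]
      exact sum_congr rfl fun _ _ => by ring)
    (fun c f g => by
      funext s; simp only [mul, Pi.smul_apply, smul_eq_mul, mul_sum]
      exact sum_congr rfl fun _ _ => by ring)

theorem lmul_apply (f g : Gr ℂ N) : lmul f g = mul f g := rfl

theorem lmul_mul (f g : Gr ℂ N) : lmul (mul f g) = lmul f * lmul g :=
  LinearMap.ext fun h => mul_assoc f g h

theorem lmul_one : lmul (one : Gr ℂ N) = 1 := LinearMap.ext one_mul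

theorem lmul_pow (f : Gr ℂ N) (k : ℕ) : lmul (pow f k) = lmul f ^ k := by
  induction k with
  | zero => exact lmul_one
  | succ k ih => rw [pow, lmul_mul, ih, pow_succ]

/-- Left multiplication by the generator `j`. -/
def genOp (j : Fin N) : Module.End ℂ (Gr ℂ N) := lmul (gen j)

theorem genOp_apply (j : Fin N) (f : Gr ℂ N) (s : Finset (Fin N)) :
    genOp j f s =
      if j ∈ s then (-1) ^ (s.filter fun i => i < j).card * f (s.erase j) else 0 :=
  gen_mul_apply j f s

/-- The left partial derivative as a linear endomorphism. -/
def derivOp (j : Fin N) : Module.End ℂ (Gr ℂ N) where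
  toFun := pderiv j
  map_add' f g := by
    funext s; simp only [pderiv, Pi.add_apply]; split_ifs <;> ring
  map_smul' c f := by
    funext s; simp only [pderiv, Pi.smul_apply, smul_eq_mul, RingHom.id_apply]
    split_ifs <;> ring

theorem derivOp_apply (j : Fin N) (f : Gr ℂ N) (s : Finset (Fin N)) :
    derivOp j f s =
      if j ∈ s then 0 else (-1) ^ (s.filter fun i => i < j).card * f (insert j s) := rfl

theorem sign_insert {s : Finset (Fin N)} {j : Fin N} (k : Fin N) (hj : j ∉ s) :
    (-1 : ℂ) ^ ((insert j s).filter fun i => i < k).card =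
      (if j < k then -1 else 1) * (-1) ^ (s.filter fun i => i < k).card := by
  rw [filter_insert]
  split_ifs
  · rw [card_insert_of_notMem (by simp [hj]), pow_succ, mul_comm]
  · simp

theorem sign_erase {s : Finset (Fin N)} {j : Fin N} (k : Fin N) (hj : j ∈ s) :
    (-1 : ℂ) ^ ((s.erase j).filter fun i => i < k).card =
      (if j < k then -1 else 1) * (-1) ^ (s.filter fun i => i < k).card := by
  conv_rhs => rw [← insert_erase hj, sign_insert k (notMem_erase j s)]
  split_ifs <;> simp

theorem derivOp_mul_genOp_self (j : Fin N) : derivOp j * genOp j = 1 - genOp j * derivOp j := by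
  refine LinearMap.ext fun f => funext fun s => ?_
  by_cases h : j ∈ s
  · have := sign_erase j h
    simp [derivOp_apply, genOp_apply, h, ← _root_.mul_assoc, ← mul_pow, filter_erase]
  · simp [derivOp_apply, genOp_apply, h, ← _root_.mul_assoc, ← mul_pow, filter_insert]

theorem derivOp_mul_genOp {j k : Fin N} (hjk : j ≠ k) :
    derivOp j * genOp k = -(genOp k * derivOp j) := by
  refine LinearMap.ext fun f => funext fun s => ?_
  simp only [Module.End.mul_apply, LinearMap.neg_apply, Pi.neg_apply, derivOp_apply, genOp_apply,
    mem_insert, mem_erase, hjk, hjk.symm, ne_eq, not_false_eq_true, false_or, true_and]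
  by_cases hj : j ∈ s <;> by_cases hk : k ∈ s <;> simp only [hj, hk, if_true, if_false, mul_zero,
    neg_zero]
  rw [sign_insert k hj, sign_erase j hk, erase_insert_of_ne hjk]
  rcases lt_or_gt_of_ne hjk with h | h <;> simp [h, h.not_gt] <;> ring

theorem derivOp_mul_derivOp (j k : Fin N) : derivOp j * derivOp k = -(derivOp k * derivOp j) := by
  refine LinearMap.ext fun f => funext fun s => ?_
  by_cases hjk : j = k
  · subst hjk; simp [derivOp_apply]
  simp only [Module.End.mul_apply, LinearMap.neg_apply, Pi.neg_apply, derivOp_apply,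
    mem_insert, hjk, Ne.symm hjk, false_or]
  by_cases hj : j ∈ s <;> by_cases hk : k ∈ s <;> simp only [hj, hk, if_true, if_false, mul_zero,
    neg_zero]
  rw [sign_insert k hj, sign_insert j hk, insert_comm]
  rcases lt_or_gt_of_ne hjk with h | h <;> simp [h, h.not_gt] <;> ring

theorem genOp_mul_genOp (j k : Fin N) : genOp j * genOp k = -(genOp k * genOp j) := by
  refine LinearMap.ext fun f => funext fun s => ?_
  by_cases hjk : j = k
  · subst hjk; simp [genOp_apply]
  simp only [Module.End.mul_apply, LinearMap.neg_apply, Pi.neg_apply, genOp_apply,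
    mem_erase, hjk, Ne.symm hjk, ne_eq, not_false_eq_true, true_and]
  by_cases hj : j ∈ s <;> by_cases hk : k ∈ s <;> simp only [hj, hk, if_true, if_false, mul_zero,
    neg_zero]
  rw [sign_erase k hj, sign_erase j hk, erase_right_comm]
  rcases lt_or_gt_of_ne hjk with h | h <;> simp [h, h.not_gt] <;> ring

end Gr

theorem mul_pow_succ_of_commutator {A : Type*} [Ring A] {D Q q : A} (h : D * Q = Q * D + q)
    (hq : Commute q Q) (k : ℕ) :
    D * Q ^ (k + 1) = Q ^ (k + 1) * D + (k + 1) • (q * Q ^ k) := by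
  induction k with
  | zero => simpa using h
  | succ k ih =>
    have : q * Q ^ k * Q = q * Q ^ (k + 1) := by rw [_root_.mul_assoc, ← pow_succ]
    rw [pow_succ Q (k + 1), ← _root_.mul_assoc, ih, add_mul, _root_.mul_assoc, h, mul_add,
      smul_mul_assoc, this, ← hq.pow_right (k + 1), succ_nsmul _ (k + 1), ← _root_.mul_assoc,
      pow_succ]
    abel

theorem mul_sum_exp_of_commutator {A : Type*} [Ring A] [Algebra ℂ A] {D Q q : A}
    (h : D * Q = Q * D + q) (hq : Commute q Q) {N : ℕ} (hN : Q ^ N = 0) :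
    D * ∑ k ∈ range (N + 1), ((k.factorial : ℂ))⁻¹ • Q ^ k =
      (∑ k ∈ range (N + 1), ((k.factorial : ℂ))⁻¹ • Q ^ k) * D +
        q * ∑ k ∈ range (N + 1), ((k.factorial : ℂ))⁻¹ • Q ^ k := by
  have hterm (k : ℕ) : D * (((k + 1).factorial : ℂ)⁻¹ • Q ^ (k + 1)) =
      (((k + 1).factorial : ℂ)⁻¹ • Q ^ (k + 1)) * D + q * ((k.factorial : ℂ)⁻¹ • Q ^ k) := by
    rw [mul_smul_comm, mul_pow_succ_of_commutator h hq, smul_add, smul_mul_assoc, mul_smul_comm,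
      ← Nat.cast_smul_eq_nsmul ℂ, smul_smul]
    congr 2
    rw [Nat.factorial_succ]
    have : (k.factorial : ℂ) ≠ 0 := by exact_mod_cast k.factorial_ne_zero
    have : ((k : ℂ) + 1) ≠ 0 := by exact_mod_cast k.succ_ne_zero
    push_cast
    field_simp
  have hlast : q * ∑ k ∈ range (N + 1), ((k.factorial : ℂ))⁻¹ • Q ^ k =
      q * ∑ k ∈ range N, ((k.factorial : ℂ))⁻¹ • Q ^ k := by
    rw [sum_range_succ, hN, smul_zero, add_zero]
  rw [hlast, sum_range_succ', mul_add, add_mul, mul_sum, sum_mul, mul_sum,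
    sum_congr rfl fun k _ => hterm k, sum_add_distrib]
  simp only [Nat.factorial_zero, Nat.cast_one, inv_one, pow_zero, one_smul, mul_one, one_mul]
  abel

namespace Gr

variable {N : ℕ}

theorem commute_genOp_mul_genOp (a b c : Fin N) : Commute (genOp a) (genOp b * genOp c) := by
  change _ * _ = _ * _
  rw [← _root_.mul_assoc, genOp_mul_genOp a b, neg_mul (genOp b * genOp a), _root_.mul_assoc,
    genOp_mul_genOp a c, mul_neg (genOp b), neg_neg, _root_.mul_assoc]

theorem derivOp_mul_genOp_eq (j k : Fin N) :
    derivOp j * genOp k = (if j = k then 1 else 0) - genOp k * derivOp j := by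
  split_ifs with h
  · subst h; exact derivOp_mul_genOp_self j
  · rw [derivOp_mul_genOp h, zero_sub]

theorem derivOp_mul_genOp_mul_genOp (z a b : Fin N) :
    derivOp z * (genOp a * genOp b) = genOp a * genOp b * derivOp z +
      ((if z = a then genOp b else 0) - if z = b then genOp a else 0) := by
  rw [← _root_.mul_assoc, derivOp_mul_genOp_eq, sub_mul, _root_.mul_assoc, derivOp_mul_genOp_eq,
    mul_sub]
  simp only [ite_mul, mul_ite, mul_one, mul_zero, _root_.one_mul, zero_mul, _root_.mul_assoc]
  abel

theorem derivOp_mul_self (j : Fin N) : derivOp j * derivOp j = 0 := by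
  refine LinearMap.ext fun f => funext fun s => ?_
  simp [derivOp_apply]

/-- Iterated left partial derivatives as a linear endomorphism. -/
def derivListOp : List (Fin N) → Module.End ℂ (Gr ℂ N)
  | [] => 1
  | j :: l => derivListOp l * derivOp j

theorem derivListOp_apply (l : List (Fin N)) (f : Gr ℂ N) : derivListOp l f = derivList l f := by
  induction l generalizing f with
  | nil => rfl
  | cons j l ih => exact ih _

theorem derivListOp_mul_of_anticommute {l : List (Fin N)} {P : Module.End ℂ (Gr ℂ N)}
    (h : ∀ i ∈ l, derivOp i * P = -(P * derivOp i)) :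
    derivListOp l * P = (-1 : ℂ) ^ l.length • (P * derivListOp l) := by
  induction l with
  | nil => simp [derivListOp]
  | cons j l ih =>
    rw [derivListOp, _root_.mul_assoc, h j (by simp), mul_neg (derivListOp l), ← _root_.mul_assoc,
      ih fun i hi => h i (by simp [hi]), List.length_cons, pow_succ, mul_neg_one,
      smul_mul_assoc, _root_.mul_assoc]
    exact (neg_smul _ _).symm

theorem derivListOp_mul_derivOp_of_mem {l : List (Fin N)} {j : Fin N} (hj : j ∈ l) :
    derivListOp l * derivOp j = 0 := by
  induction l with
  | nil => simp at hj
  | cons i l ih =>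
    rw [derivListOp, _root_.mul_assoc]
    rcases List.mem_cons.mp hj with rfl | hj
    · rw [derivOp_mul_self, mul_zero]
    · rw [derivOp_mul_derivOp, mul_neg (derivListOp l), ← _root_.mul_assoc, ih hj, zero_mul,
        neg_zero]

end Gr

section Fermionic

open Gr

variable {n : ℕ}

theorem xi_injective : Function.Injective (xi n) := Fin.castAdd_injective _ _

theorem yi_injective : Function.Injective (yi n) := Fin.natAdd_injective _ _

theorem xi_ne_yi (s t : Fin (2 * n)) : xi n s ≠ yi n t := by
  intro h
  have := congrArg Fin.val h
  simp only [xi, yi, Fin.val_castAdd, Fin.val_natAdd] at this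
  omega

theorem lo_injective : Function.Injective (lo n) := fun i j h => by
  have := congrArg Fin.val h
  simp only [lo] at this
  omega

theorem hi_injective : Function.Injective (hi n) := fun i j h => by
  have := congrArg Fin.val h
  simp only [hi] at this
  omega

theorem lo_ne_hi (i j : Fin n) : lo n i ≠ hi n j := fun h => by
  have := congrArg Fin.val h
  simp only [lo, hi] at this
  omega

theorem card_filter_image_xi (A : Finset (Fin (2 * n))) (t : Fin (2 * n)) :
    ((A.image (xi n)).filter fun i => i < xi n t).card = (A.filter fun i => i < t).card := by
  rw [filter_image, card_image_of_injective _ xi_injective]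
  rfl

theorem card_filter_image_yi (A : Finset (Fin (2 * n))) (t : Fin (2 * n)) :
    ((A.image (yi n)).filter fun i => i < yi n t).card = (A.filter fun i => i < t).card := by
  rw [filter_image, card_image_of_injective _ yi_injective]
  simp [yi]

/-- `embX` as a linear map. -/
def embXL (n : ℕ) : Gr ℂ (2 * n) →ₗ[ℂ] Gr ℂ (2 * n + 2 * n) where
  toFun := embX n
  map_add' f g := by
    funext s
    simp only [embX, Pi.add_apply, ← sum_add_distrib]
    exact sum_congr rfl fun _ _ => by split_ifs <;> simp
  map_smul' c f := by
    funext s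
    simp [embX, mul_sum]

theorem embXL_apply_image (f : Gr ℂ (2 * n)) (A : Finset (Fin (2 * n))) :
    embXL n f (A.image (xi n)) = f A := by
  change embX n f _ = _
  simp [embX, (image_injective xi_injective).eq_iff]

theorem embXL_apply_of_forall_ne (f : Gr ℂ (2 * n)) {s : Finset (Fin (2 * n + 2 * n))}
    (h : ∀ A : Finset (Fin (2 * n)), s ≠ A.image (xi n)) : embXL n f s = 0 := by
  change embX n f _ = _
  simp [embX, h]

theorem embXL_genOp (t : Fin (2 * n)) (f : Gr ℂ (2 * n)) :
    embXL n (genOp t f) = genOp (xi n t) (embXL n f) := by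
  funext s
  by_cases h : ∃ A : Finset (Fin (2 * n)), s = A.image (xi n)
  · obtain ⟨A, rfl⟩ := h
    rw [embXL_apply_image, genOp_apply, genOp_apply, card_filter_image_xi,
      ← image_erase xi_injective, embXL_apply_image]
    simp only [xi_injective.mem_finset_image]
  · push Not at h
    rw [embXL_apply_of_forall_ne _ h, genOp_apply]
    split_ifs with ht
    · rw [embXL_apply_of_forall_ne, mul_zero]
      intro A hA
      refine h (insert t A) ?_
      rw [image_insert, ← hA, insert_erase ht]
    · rfl

theorem embXL_derivOp (t : Fin (2 * n)) (f : Gr ℂ (2 * n)) :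
    embXL n (derivOp t f) = derivOp (xi n t) (embXL n f) := by
  funext s
  by_cases h : ∃ A : Finset (Fin (2 * n)), s = A.image (xi n)
  · obtain ⟨A, rfl⟩ := h
    rw [embXL_apply_image, derivOp_apply, derivOp_apply, card_filter_image_xi,
      ← image_insert, embXL_apply_image]
    simp only [xi_injective.mem_finset_image]
  · push Not at h
    rw [embXL_apply_of_forall_ne _ h, derivOp_apply]
    split_ifs with ht
    · rfl
    · rw [embXL_apply_of_forall_ne, mul_zero]
      intro A hA
      refine h (A.erase t) ?_
      rw [image_erase xi_injective, ← hA, erase_insert ht]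

theorem derivOp_yi_embXL (t : Fin (2 * n)) (f : Gr ℂ (2 * n)) :
    derivOp (yi n t) (embXL n f) = 0 := by
  funext s
  rw [derivOp_apply, embXL_apply_of_forall_ne f, mul_zero, ite_self, Pi.zero_apply]
  intro A hA
  have : yi n t ∈ A.image (xi n) := hA ▸ mem_insert_self _ _
  obtain ⟨u, -, hu⟩ := mem_image.mp this
  exact xi_ne_yi u t hu

/-- Restriction of an element of the mixed algebra to the monomials in the `y` generators. -/
def restrictY (n : ℕ) : Gr ℂ (2 * n + 2 * n) →ₗ[ℂ] Gr ℂ (2 * n) :=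
  LinearMap.funLeft ℂ ℂ fun s => s.image (yi n)

theorem restrictY_apply (F : Gr ℂ (2 * n + 2 * n)) (s : Finset (Fin (2 * n))) :
    restrictY n F s = F (s.image (yi n)) := rfl

theorem restrictY_genOp (t : Fin (2 * n)) (F : Gr ℂ (2 * n + 2 * n)) :
    restrictY n (genOp (yi n t) F) = genOp t (restrictY n F) := by
  funext s
  rw [restrictY_apply, genOp_apply, genOp_apply, restrictY_apply, card_filter_image_yi,
    ← image_erase yi_injective]
  simp only [yi_injective.mem_finset_image]

theorem restrictY_derivOp (t : Fin (2 * n)) (F : Gr ℂ (2 * n + 2 * n)) :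
    restrictY n (derivOp (yi n t) F) = derivOp t (restrictY n F) := by
  funext s
  rw [restrictY_apply, derivOp_apply, derivOp_apply, restrictY_apply, card_filter_image_yi,
    ← image_insert]
  simp only [yi_injective.mem_finset_image]

/-- The operator `∂_{x_{2n}} ⋯ ∂_{x_1}` on the mixed algebra. -/
def topDerivX (n : ℕ) : Module.End ℂ (Gr ℂ (2 * n + 2 * n)) :=
  derivListOp ((List.finRange (2 * n)).map (xi n))

theorem topDerivX_mul_derivOp_xi (t : Fin (2 * n)) : topDerivX n * derivOp (xi n t) = 0 :=
  derivListOp_mul_derivOp_of_mem (List.mem_map_of_mem (List.mem_finRange t))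

theorem topDerivX_commute_of_anticommute {P : Module.End ℂ (Gr ℂ (2 * n + 2 * n))}
    (h : ∀ t, derivOp (xi n t) * P = -(P * derivOp (xi n t))) : Commute (topDerivX n) P := by
  change _ * _ = _ * _
  rw [topDerivX, derivListOp_mul_of_anticommute (by simpa using h)]
  simp

theorem topDerivX_commute_genOp_yi (t : Fin (2 * n)) :
    Commute (topDerivX n) (genOp (yi n t)) :=
  topDerivX_commute_of_anticommute fun s => derivOp_mul_genOp (xi_ne_yi s t)

theorem topDerivX_commute_derivOp_yi (t : Fin (2 * n)) :
    Commute (topDerivX n) (derivOp (yi n t)) :=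
  topDerivX_commute_of_anticommute fun _ => derivOp_mul_derivOp _ _

/-- The even quadratic form in the exponent of the fermionic Fourier kernel. -/
def kerForm (n : ℕ) (σ : ℂ) : Gr ℂ (2 * n + 2 * n) :=
  (-σ * (Complex.I / 2)) • ∑ j : Fin n,
    (Gr.mul (Gr.gen (xi n (lo n j))) (Gr.gen (yi n (hi n j))) -
     Gr.mul (Gr.gen (xi n (hi n j))) (Gr.gen (yi n (lo n j))))

theorem lmul_kerForm (σ : ℂ) : lmul (kerForm n σ) = (-σ * (Complex.I / 2)) • ∑ j : Fin n,
    (genOp (xi n (lo n j)) * genOp (yi n (hi n j)) -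
      genOp (xi n (hi n j)) * genOp (yi n (lo n j))) := by
  simp only [kerForm, map_smul, map_sum, map_sub, lmul_mul, genOp]

theorem commute_genOp_lmul_kerForm (σ : ℂ) (a : Fin (2 * n + 2 * n)) :
    Commute (genOp a) (lmul (kerForm n σ)) := by
  rw [lmul_kerForm]
  exact (Commute.sum_right _ _ _ fun j _ => (commute_genOp_mul_genOp _ _ _).sub_right
    (commute_genOp_mul_genOp _ _ _)).smul_right _

theorem lmul_kerForm_pow_eq_zero (σ : ℂ) (hn : 0 < n) :
    lmul (kerForm n σ) ^ (2 * n + 2 * n) = 0 := by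
  have hgg (a b : Fin (2 * n + 2 * n)) (s : Finset (Fin (2 * n + 2 * n))) (hs : s.card ≠ 2) :
      mul (gen a : Gr ℂ _) (gen b) s = 0 :=
    mul_apply_eq_zero_of_card (gen_apply_eq_zero_of_card a) (gen_apply_eq_zero_of_card b) s hs
  have hQ (s : Finset (Fin (2 * n + 2 * n))) (hs : s.card ≠ 2) : kerForm n σ s = 0 := by
    simp [kerForm, hgg _ _ s hs]
  have : pow (kerForm n σ) (2 * n + 2 * n) = 0 := by
    funext s
    refine pow_apply_eq_zero_of_card hQ _ s ?_
    have := card_le_univ s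
    rw [Fintype.card_fin] at this
    omega
  rw [← lmul_pow, this, map_zero]

theorem lmul_fermK (σ : ℂ) : lmul (fermK n σ) =
    ∑ k ∈ range (2 * n + 2 * n + 1), ((k.factorial : ℂ))⁻¹ • lmul (kerForm n σ) ^ k := by
  change lmul (gexp (kerForm n σ)) = _
  simp only [gexp, map_sum, map_smul, lmul_pow]

theorem commute_genOp_lmul_fermK (σ : ℂ) (a : Fin (2 * n + 2 * n)) :
    Commute (genOp a) (lmul (fermK n σ)) := by
  rw [lmul_fermK]
  exact Commute.sum_right _ _ _ fun k _ =>
    ((commute_genOp_lmul_kerForm σ a).pow_right k).smul_right _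

theorem derivOp_mul_lmul_fermK {σ c : ℂ} (hn : 0 < n) {z u : Fin (2 * n + 2 * n)}
    (h : derivOp z * lmul (kerForm n σ) = lmul (kerForm n σ) * derivOp z + c • genOp u) :
    derivOp z * lmul (fermK n σ) =
      lmul (fermK n σ) * derivOp z + c • (genOp u * lmul (fermK n σ)) := by
  rw [lmul_fermK, mul_sum_exp_of_commutator h ((commute_genOp_lmul_kerForm σ u).smul_left c)
    (lmul_kerForm_pow_eq_zero σ hn), smul_mul_assoc]

theorem derivOp_mul_lmul_kerForm (σ : ℂ) (z : Fin (2 * n + 2 * n)) :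
    derivOp z * lmul (kerForm n σ) = lmul (kerForm n σ) * derivOp z +
      (-σ * (Complex.I / 2)) • ∑ j : Fin n,
        (((if z = xi n (lo n j) then genOp (yi n (hi n j)) else 0) -
            if z = yi n (hi n j) then genOp (xi n (lo n j)) else 0) -
          ((if z = xi n (hi n j) then genOp (yi n (lo n j)) else 0) -
            if z = yi n (lo n j) then genOp (xi n (hi n j)) else 0)) := by
  rw [lmul_kerForm, mul_smul_comm, smul_mul_assoc, ← smul_add, mul_sum, sum_mul,
    ← sum_add_distrib]
  congr 1
  refine sum_congr rfl fun j _ => ?_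
  rw [mul_sub, derivOp_mul_genOp_mul_genOp, derivOp_mul_genOp_mul_genOp, sub_mul]
  abel

theorem derivOp_xi_lo_mul_fermK (σ : ℂ) (t : Fin n) :
    derivOp (xi n (lo n t)) * lmul (fermK n σ) = lmul (fermK n σ) * derivOp (xi n (lo n t)) +
      (-σ * (Complex.I / 2)) • (genOp (yi n (hi n t)) * lmul (fermK n σ)) := by
  refine derivOp_mul_lmul_fermK t.pos ?_
  simp [derivOp_mul_lmul_kerForm, xi_injective.eq_iff, xi_ne_yi, lo_injective.eq_iff, lo_ne_hi]

theorem derivOp_xi_hi_mul_fermK (σ : ℂ) (t : Fin n) :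
    derivOp (xi n (hi n t)) * lmul (fermK n σ) = lmul (fermK n σ) * derivOp (xi n (hi n t)) +
      (σ * (Complex.I / 2)) • (genOp (yi n (lo n t)) * lmul (fermK n σ)) := by
  refine derivOp_mul_lmul_fermK t.pos ?_
  simp [derivOp_mul_lmul_kerForm, xi_injective.eq_iff, xi_ne_yi, hi_injective.eq_iff,
    (lo_ne_hi _ _).symm]

theorem derivOp_yi_lo_mul_fermK (σ : ℂ) (t : Fin n) :
    derivOp (yi n (lo n t)) * lmul (fermK n σ) = lmul (fermK n σ) * derivOp (yi n (lo n t)) +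
      (-σ * (Complex.I / 2)) • (genOp (xi n (hi n t)) * lmul (fermK n σ)) := by
  refine derivOp_mul_lmul_fermK t.pos ?_
  simp [derivOp_mul_lmul_kerForm, yi_injective.eq_iff, (xi_ne_yi _ _).symm, lo_injective.eq_iff,
    lo_ne_hi]

theorem derivOp_yi_hi_mul_fermK (σ : ℂ) (t : Fin n) :
    derivOp (yi n (hi n t)) * lmul (fermK n σ) = lmul (fermK n σ) * derivOp (yi n (hi n t)) +
      (σ * (Complex.I / 2)) • (genOp (xi n (lo n t)) * lmul (fermK n σ)) := by
  refine derivOp_mul_lmul_fermK t.pos ?_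
  simp [derivOp_mul_lmul_kerForm, yi_injective.eq_iff, (xi_ne_yi _ _).symm, hi_injective.eq_iff,
    (lo_ne_hi _ _).symm]

/-- The unnormalised fermionic Fourier transform `g ↦ ∫_{B,x} K^σ(x,y) g(x)`. -/
def fermFTL (n : ℕ) (σ : ℂ) : Module.End ℂ (Gr ℂ (2 * n)) :=
  ((Real.pi : ℂ) ^ n)⁻¹ •
    (restrictY n ∘ₗ topDerivX n ∘ₗ lmul (fermK n σ) ∘ₗ embXL n)

theorem fermFTL_apply (σ : ℂ) (f : Gr ℂ (2 * n)) (s : Finset (Fin (2 * n))) :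
    fermFTL n σ f s = berezinX n (Gr.mul (fermK n σ) (embX n f)) (s.image (yi n)) := by
  simp only [berezinX, ← derivListOp_apply]
  rfl

theorem fermFTL_derivOp {σ c : ℂ} {t u : Fin (2 * n)}
    (h : derivOp (xi n t) * lmul (fermK n σ) = lmul (fermK n σ) * derivOp (xi n t) +
      c • (genOp (yi n u) * lmul (fermK n σ))) (f : Gr ℂ (2 * n)) :
    fermFTL n σ (derivOp t f) = -c • genOp u (fermFTL n σ f) := by
  have h' : topDerivX n * lmul (fermK n σ) * derivOp (xi n t) =
      -c • (genOp (yi n u) * (topDerivX n * lmul (fermK n σ))) := by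
    rw [_root_.mul_assoc, ← sub_eq_iff_eq_add.mpr h, mul_sub, ← _root_.mul_assoc,
      topDerivX_mul_derivOp_xi, zero_mul, zero_sub, mul_smul_comm, ← _root_.mul_assoc,
      (topDerivX_commute_genOp_yi u).eq, _root_.mul_assoc]
    exact (neg_smul _ _).symm
  have h'' := congrArg (restrictY n) (LinearMap.congr_fun h' (embXL n f))
  simp only [LinearMap.smul_apply, map_smul, Module.End.mul_apply, restrictY_genOp,
    ← embXL_derivOp] at h''
  simp only [fermFTL, LinearMap.smul_apply, LinearMap.comp_apply, map_smul]
  rw [h'', smul_comm]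

theorem derivOp_fermFTL {σ c : ℂ} {t u : Fin (2 * n)}
    (h : derivOp (yi n t) * lmul (fermK n σ) = lmul (fermK n σ) * derivOp (yi n t) +
      c • (genOp (xi n u) * lmul (fermK n σ))) (f : Gr ℂ (2 * n)) :
    derivOp t (fermFTL n σ f) = c • fermFTL n σ (genOp u f) := by
  have h' : derivOp (yi n t) * (topDerivX n * lmul (fermK n σ)) =
      topDerivX n * lmul (fermK n σ) * derivOp (yi n t) +
        c • (topDerivX n * lmul (fermK n σ) * genOp (xi n u)) := by
    rw [← _root_.mul_assoc, ← (topDerivX_commute_derivOp_yi t).eq, _root_.mul_assoc, h, mul_add,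
      mul_smul_comm, (commute_genOp_lmul_fermK σ (xi n u)).eq, _root_.mul_assoc, _root_.mul_assoc]
  have h'' := congrArg (restrictY n) (LinearMap.congr_fun h' (embXL n f))
  simp only [LinearMap.smul_apply, LinearMap.add_apply, map_smul, Module.End.mul_apply,
    restrictY_derivOp, derivOp_yi_embXL, map_zero, zero_add, ← embXL_genOp] at h''
  simp only [fermFTL, LinearMap.smul_apply, LinearMap.comp_apply, map_smul]
  rw [h'', smul_comm]

theorem sign_mul_I_half_sq {σ : ℂ} (hσ : σ = 1 ∨ σ = -1) :
    (σ * (Complex.I / 2)) * (σ * (Complex.I / 2)) = -(1 / 4) := by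
  rcases hσ with rfl | rfl <;> ring_nf <;> rw [Complex.I_sq] <;> ring

theorem lmul_xsq : lmul (xsq n) = ∑ j : Fin n, genOp (lo n j) * genOp (hi n j) := by
  simp only [xsq, map_sum, lmul_mul, genOp]

/-- The fermionic Laplace operator as a linear endomorphism. -/
def lapFL (n : ℕ) : Module.End ℂ (Gr ℂ (2 * n)) :=
  (4 : ℂ) • ∑ j : Fin n, derivOp (lo n j) * derivOp (hi n j)

theorem lapFL_apply (f : Gr ℂ (2 * n)) : lapFL n f = lapF n f := by
  simp only [lapFL, LinearMap.smul_apply, LinearMap.sum_apply]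
  rfl

theorem fermFTL_lapFL {σ : ℂ} (hσ : σ = 1 ∨ σ = -1) (f : Gr ℂ (2 * n)) :
    fermFTL n σ (lapFL n f) = -lmul (xsq n) (fermFTL n σ f) := by
  simp only [lapFL, lmul_xsq, LinearMap.smul_apply, LinearMap.sum_apply, Module.End.mul_apply,
    map_smul, map_sum, fermFTL_derivOp (derivOp_xi_lo_mul_fermK σ _),
    fermFTL_derivOp (derivOp_xi_hi_mul_fermK σ _), smul_smul, smul_sum, ← sum_neg_distrib]
  refine sum_congr rfl fun j _ => ?_
  have := LinearMap.congr_fun (genOp_mul_genOp (hi n j) (lo n j)) (fermFTL n σ f)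
  simp only [Module.End.mul_apply, LinearMap.neg_apply] at this
  rw [this, smul_neg, ← one_smul ℂ (genOp (lo n j) _), smul_smul]
  congr 2
  linear_combination (-4) * sign_mul_I_half_sq hσ

theorem lapFL_fermFTL {σ : ℂ} (hσ : σ = 1 ∨ σ = -1) (f : Gr ℂ (2 * n)) :
    lapFL n (fermFTL n σ f) = -fermFTL n σ (lmul (xsq n) f) := by
  simp only [lapFL, lmul_xsq, LinearMap.smul_apply, LinearMap.sum_apply, Module.End.mul_apply,
    map_smul, map_sum, derivOp_fermFTL (derivOp_yi_lo_mul_fermK σ _),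
    derivOp_fermFTL (derivOp_yi_hi_mul_fermK σ _), smul_smul, smul_sum, ← sum_neg_distrib]
  refine sum_congr rfl fun j _ => ?_
  have := LinearMap.congr_fun (genOp_mul_genOp (hi n j) (lo n j)) f
  simp only [Module.End.mul_apply, LinearMap.neg_apply] at this
  rw [this, map_neg, smul_neg, ← one_smul ℂ (fermFTL n σ (genOp (lo n j) _)), smul_smul]
  congr 2
  linear_combination (-4) * sign_mul_I_half_sq hσ

end Fermionic

open scoped LineDeriv SchwartzMap

section Bosonic

variable {m : ℕ} {E : Type*} [NormedAddCommGroup E] [NormedSpace ℂ E]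

/-- The bilinear form `(x, y) ↦ -(r / 2π) Σ_i x_i y_i`, normalised so that `Real.fourierChar`
turns its opposite into `exp(r i Σ_i x_i y_i)`. -/
def kernelForm (m : ℕ) (r : ℝ) : (Fin m → ℝ) →L[ℝ] (Fin m → ℝ) →L[ℝ] ℝ :=
  ∑ i, (-(r / (2 * Real.pi))) •
    (ContinuousLinearMap.proj (R := ℝ) (φ := fun _ : Fin m => ℝ) i).smulRight
      (ContinuousLinearMap.proj (R := ℝ) (φ := fun _ : Fin m => ℝ) i)

theorem kernelForm_apply (r : ℝ) (x y : Fin m → ℝ) :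
    kernelForm m r x y = -(r / (2 * Real.pi)) * ∑ i, x i * y i := by
  simp [kernelForm, Finset.mul_sum]

theorem fourierChar_neg_kernelForm (r : ℝ) (x y : Fin m → ℝ) :
    (Real.fourierChar (-kernelForm m r x y) : ℂ) =
      Complex.exp (r * Complex.I * ∑ i, (x i : ℂ) * (y i : ℂ)) := by
  have hπ : (Real.pi : ℂ) ≠ 0 := by exact_mod_cast Real.pi_ne_zero
  rw [Real.fourierChar_apply, kernelForm_apply]
  congr 1
  push_cast
  field_simp

theorem fourierIntegral_kernelForm (r : ℝ) (f : (Fin m → ℝ) → E) (y : Fin m → ℝ) :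
    VectorFourier.fourierIntegral Real.fourierChar volume (kernelForm m r).toLinearMap₁₂ f y =
      ∫ x, Complex.exp (r * Complex.I * ∑ i, (x i : ℂ) * (y i : ℂ)) • f x := by
  refine integral_congr_ae (Filter.Eventually.of_forall fun x => ?_)
  change (Real.fourierChar (-kernelForm m r x y) : ℂ) • f x = _
  rw [fourierChar_neg_kernelForm]

theorem integrable_exp_smul (r : ℝ) {f : (Fin m → ℝ) → E} (hf : Integrable f) (y : Fin m → ℝ) :
    Integrable fun x => Complex.exp (r * Complex.I * ∑ i, (x i : ℂ) * (y i : ℂ)) • f x := by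
  refine ((Real.fourierIntegral_convergent_iff' (kernelForm m r) y).2 hf).congr
    (Filter.Eventually.of_forall fun x => ?_)
  change (Real.fourierChar (-kernelForm m r x y) : ℂ) • f x = _
  rw [fourierChar_neg_kernelForm]

/-- The unnormalised Fourier transform `G ↦ ∫ exp(r i Σ_i x_i y_i) G(x) dV(x)` evaluated at `y`. -/
def bosFT (r : ℝ) (y : Fin m → ℝ) : 𝓢(Fin m → ℝ, E) →ₗ[ℂ] E where
  toFun G := ∫ x, Complex.exp (r * Complex.I * ∑ i, (x i : ℂ) * (y i : ℂ)) • G x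
  map_add' G H := by
    simp only [add_apply, smul_add]
    exact integral_add (integrable_exp_smul r G.integrable y) (integrable_exp_smul r H.integrable y)
  map_smul' c G := by
    simp only [smul_apply, smul_comm _ c, RingHom.id_apply]
    exact integral_smul c _

theorem bosFT_apply (r : ℝ) (y : Fin m → ℝ) (G : 𝓢(Fin m → ℝ, E)) :
    bosFT r y G = ∫ x, Complex.exp (r * Complex.I * ∑ i, (x i : ℂ) * (y i : ℂ)) • G x := rfl

theorem bosFT_eq_fourierIntegral (r : ℝ) (G : 𝓢(Fin m → ℝ, E)) :
    (fun y => bosFT r y G) = VectorFourier.fourierIntegral Real.fourierChar volume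
      (kernelForm m r).toLinearMap₁₂ G :=
  funext fun y => (fourierIntegral_kernelForm r G y).symm

theorem bosFT_postcompCLM {F : Type*} [NormedAddCommGroup F] [NormedSpace ℂ F] [CompleteSpace E]
    [CompleteSpace F] (r : ℝ) (y : Fin m → ℝ) (T : E →L[ℂ] F) (G : 𝓢(Fin m → ℝ, E)) :
    bosFT r y (G.postcompCLM T) = T (bosFT r y G) := by
  rw [bosFT_apply, bosFT_apply, ← T.integral_comp_comm (integrable_exp_smul r G.integrable y)]
  simp

theorem two_pi_I_mul_kernelForm (r : ℝ) (x y : Fin m → ℝ) :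
    2 * Real.pi * Complex.I * (kernelForm m r x y : ℂ) =
      -(r * Complex.I * ∑ i, (x i : ℂ) * (y i : ℂ)) := by
  have hπ : (Real.pi : ℂ) ≠ 0 := by exact_mod_cast Real.pi_ne_zero
  rw [kernelForm_apply]
  push_cast
  field_simp

theorem sum_mul_single (x : Fin m → ℝ) (i : Fin m) :
    ∑ j, (x j : ℂ) * ((Pi.single i (1 : ℝ) : Fin m → ℝ) j : ℂ) = x i := by
  rw [Finset.sum_eq_single i (fun j _ hj => by simp [hj]) (by simp)]
  simp

theorem sum_single_mul (x : Fin m → ℝ) (i : Fin m) :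
    ∑ j, ((Pi.single i (1 : ℝ) : Fin m → ℝ) j : ℂ) * (x j : ℂ) = x i := by
  simpa only [mul_comm] using sum_mul_single x i

theorem bosFT_lineDeriv [CompleteSpace E] (r : ℝ) (y : Fin m → ℝ) (i : Fin m)
    (G : 𝓢(Fin m → ℝ, E)) :
    bosFT r y (∂_{(Pi.single i 1 : Fin m → ℝ)} G) = (-(r * Complex.I * y i)) • bosFT r y G := by
  have h := congrArg (fun T => T y (Pi.single i 1 : Fin m → ℝ))
    (VectorFourier.fourierIntegral_fderiv (kernelForm m r) (G.integrable (μ := volume))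
      G.differentiable ((SchwartzMap.fderivCLM ℂ (Fin m → ℝ) E G).integrable (μ := volume)))
  simp only [VectorFourier.fourierSMulRight_apply, ← bosFT_eq_fourierIntegral] at h
  rw [fourierIntegral_kernelForm, ContinuousLinearMap.integral_apply] at h
  · refine h.trans ?_
    rw [neg_apply, neg_apply, ContinuousLinearMap.flip_apply, ← Complex.coe_smul, smul_smul]
    congr 1
    have := two_pi_I_mul_kernelForm r (Pi.single i 1) y
    rw [sum_single_mul] at this
    push_cast
    linear_combination this
  · exact integrable_exp_smul r
      ((SchwartzMap.fderivCLM ℂ (Fin m → ℝ) E G).integrable (μ := volume)) y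

/-- Multiplication of a Schwartz function by the coordinate `x_i`. -/
def coordMul (i : Fin m) : 𝓢(Fin m → ℝ, E) →L[ℂ] 𝓢(Fin m → ℝ, E) :=
  SchwartzMap.smulLeftCLM E (fun x : Fin m → ℝ => (x i : ℂ))

theorem coordMul_apply (i : Fin m) (G : 𝓢(Fin m → ℝ, E)) (x : Fin m → ℝ) :
    coordMul i G x = (x i : ℂ) • G x := by
  refine SchwartzMap.smulLeftCLM_apply_apply ?_ G x
  exact (Complex.ofRealCLM ∘L ContinuousLinearMap.proj (R := ℝ) (φ := fun _ : Fin m => ℝ)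
    i).hasTemperateGrowth

theorem hasFDerivAt_bosFT [CompleteSpace E] (r : ℝ) (y : Fin m → ℝ) (G : 𝓢(Fin m → ℝ, E)) :
    ∃ D : (Fin m → ℝ) →L[ℝ] E, HasFDerivAt (fun y => bosFT r y G) D y ∧
      ∀ i, D (Pi.single i 1) = (r * Complex.I) • bosFT r y (coordMul i G) := by
  have hi : Integrable (fun x : Fin m → ℝ => ‖x‖ * ‖G x‖) := by
    simpa using G.integrable_pow_mul volume 1
  have h := VectorFourier.hasFDerivAt_fourierIntegral (kernelForm m r)
    (G.integrable (μ := volume)) hi y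
  rw [← bosFT_eq_fourierIntegral] at h
  refine ⟨_, h, fun i => ?_⟩
  rw [fourierIntegral_kernelForm, ContinuousLinearMap.integral_apply]
  · rw [bosFT_apply, ← integral_smul]
    refine integral_congr_ae (Filter.Eventually.of_forall fun x => ?_)
    simp only [smul_apply, VectorFourier.fourierSMulRight_apply, coordMul_apply]
    rw [← Complex.coe_smul, smul_smul, smul_smul, smul_smul, smul_smul]
    congr 1
    have := two_pi_I_mul_kernelForm r x (Pi.single i 1)
    rw [sum_mul_single] at this
    linear_combination -Complex.exp (r * Complex.I * ∑ i, (x i : ℂ) * (y i : ℂ)) * this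
  · refine integrable_exp_smul r ?_ y
    refine (hi.const_mul (2 * Real.pi * ‖kernelForm m r‖)).mono'
      (AEStronglyMeasurable.fourierSMulRight G.integrable.1) ?_
    refine Filter.Eventually.of_forall fun x => ?_
    simpa only [_root_.mul_assoc] using VectorFourier.norm_fourierSMulRight_le (kernelForm m r) G x

end Bosonic

section Super

open Gr

variable {m n : ℕ}

theorem IsSchwartz.exists_schwartzMap {g : SF m n} (hg : IsSchwartz m n g) :
    ∃ G : 𝓢(Fin m → ℝ, Gr ℂ (2 * n)), g = ⇑G := by
  choose φ hφ using hg
  refine ⟨∑ s, (φ s).postcompCLM (ContinuousLinearMap.single ℂ (fun _ => ℂ) s), ?_⟩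
  ext x s
  rw [hφ, _root_.sum_apply, Finset.sum_apply, Finset.sum_eq_single s]
  · simp
  · intro t _ hts
    simp [hts.symm]
  · simp

theorem bderiv_apply_of_hasFDerivAt {f : SF m n} {x : Fin m → ℝ}
    {D : (Fin m → ℝ) →L[ℝ] Gr ℂ (2 * n)} (h : HasFDerivAt f D x) (i : Fin m) :
    bderiv m n i f x = D (Pi.single i 1) := by
  ext s
  rw [bderiv, ((hasFDerivAt_pi'.1 h) s).fderiv]
  rfl

theorem bderiv_schwartzMap (i : Fin m) (G : 𝓢(Fin m → ℝ, Gr ℂ (2 * n))) :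
    bderiv m n i G =
      ⇑(∂_{(Pi.single i 1 : Fin m → ℝ)} G : 𝓢(Fin m → ℝ, Gr ℂ (2 * n))) :=
  funext fun _ => bderiv_apply_of_hasFDerivAt G.differentiableAt.hasFDerivAt i

/-- The continuous linear map underlying an endomorphism of the Grassmann algebra. -/
def toCLM {N : ℕ} (T : Module.End ℂ (Gr ℂ N)) : Gr ℂ N →L[ℂ] Gr ℂ N :=
  LinearMap.toContinuousLinearMap T

theorem toCLM_apply {N : ℕ} (T : Module.End ℂ (Gr ℂ N)) (f : Gr ℂ N) : toCLM T f = T f := rfl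

theorem superLap_schwartzMap (G : 𝓢(Fin m → ℝ, Gr ℂ (2 * n))) :
    superLap m n G = ⇑(G.postcompCLM (toCLM (lapFL n)) -
      ∑ i, ∂_{(Pi.single i 1 : Fin m → ℝ)} (∂_{(Pi.single i 1 : Fin m → ℝ)} G)) := by
  funext x
  simp only [superLap, bderiv_schwartzMap, sub_apply, _root_.sum_apply,
    SchwartzMap.postcompCLM_apply, toCLM_apply, lapFL_apply]

theorem mul_xsqElem (x : Fin m → ℝ) (f : Gr ℂ (2 * n)) :
    Gr.mul (xsqElem m n x) f = lmul (xsq n) f - (∑ i, (x i : ℂ) ^ 2) • f := by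
  rw [xsqElem, ← lmul_apply, map_add, map_smul, lmul_one]
  change lmul (xsq n) f + (-∑ i, (x i : ℂ) ^ 2) • f = _
  rw [neg_smul, ← sub_eq_add_neg]

theorem mul_xsqElem_schwartzMap (G : 𝓢(Fin m → ℝ, Gr ℂ (2 * n))) :
    (fun x => Gr.mul (xsqElem m n x) (G x)) = ⇑(G.postcompCLM (toCLM (lmul (xsq n))) -
      ∑ i, coordMul i (coordMul i G)) := by
  funext x
  simp only [mul_xsqElem, sub_apply, _root_.sum_apply, SchwartzMap.postcompCLM_apply,
    toCLM_apply, coordMul_apply, smul_smul, Finset.sum_smul, sq]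

/-- The normalising constant `(2π)^{-M/2}` of the super Fourier transform. -/
def superFTConst (m n : ℕ) : ℂ := ((2 * Real.pi : ℝ) : ℂ) ^ ((-((m : ℂ) - 2 * (n : ℂ))) / 2)

theorem superFT_schwartzMap (r : ℝ) (G : 𝓢(Fin m → ℝ, Gr ℂ (2 * n))) :
    superFT m n r G = fun y => superFTConst m n • fermFTL n r (bosFT r y G) := by
  funext y
  rw [← toCLM_apply, ← bosFT_postcompCLM]
  ext s
  rw [superFT, Pi.smul_apply, smul_eq_mul, superFTConst]
  congr 1
  refine Eq.trans ?_ (bosFT_postcompCLM r y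
    (ContinuousLinearMap.proj (R := ℂ) (φ := fun _ : Finset (Fin (2 * n)) => ℂ) s) _)
  rw [bosFT_apply]
  refine integral_congr_ae (Filter.Eventually.of_forall fun x => ?_)
  simp only [SchwartzMap.postcompCLM_apply, ContinuousLinearMap.proj_apply, toCLM_apply,
    fermFTL_apply, smul_eq_mul]

theorem bderiv_superFT (r : ℝ) (i : Fin m) (G : 𝓢(Fin m → ℝ, Gr ℂ (2 * n))) :
    bderiv m n i (superFT m n r G) = superFT m n r ⇑((r * Complex.I) • coordMul i G) := by
  rw [superFT_schwartzMap, superFT_schwartzMap]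
  funext y
  obtain ⟨D, hD, hDi⟩ := hasFDerivAt_bosFT r y G
  have h := ((superFTConst m n • toCLM (fermFTL n r)).restrictScalars ℝ).hasFDerivAt.comp y hD
  refine (bderiv_apply_of_hasFDerivAt h i).trans ?_
  rw [ContinuousLinearMap.comp_apply, hDi, map_smul (bosFT r y)]
  rfl

theorem bderiv_bderiv_superFT {r : ℝ} (hr : (r : ℂ) ^ 2 = 1) (i : Fin m)
    (G : 𝓢(Fin m → ℝ, Gr ℂ (2 * n))) :
    bderiv m n i (bderiv m n i (superFT m n r G)) =
      superFT m n r ⇑(-coordMul i (coordMul i G)) := by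
  have hc : (r * Complex.I) * (r * Complex.I) = -1 := by
    linear_combination Complex.I ^ 2 * hr + Complex.I_sq
  rw [bderiv_superFT, bderiv_superFT, map_smul, smul_smul, hc, neg_one_smul]

theorem superFT_superLap {r : ℝ} (hr : (r : ℂ) = 1 ∨ (r : ℂ) = -1)
    (G : 𝓢(Fin m → ℝ, Gr ℂ (2 * n))) (y : Fin m → ℝ) :
    superFT m n r (superLap m n G) y = -Gr.mul (xsqElem m n y) (superFT m n r G y) := by
  have hr2 : (r : ℂ) ^ 2 = 1 := by rcases hr with h | h <;> simp [h]
  have hc (i : Fin m) : -(r * Complex.I * y i) * -(r * Complex.I * y i) = -(y i : ℂ) ^ 2 := by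
    linear_combination (Complex.I ^ 2 * (y i : ℂ) ^ 2) * hr2 + (y i : ℂ) ^ 2 * Complex.I_sq
  rw [superLap_schwartzMap, superFT_schwartzMap, superFT_schwartzMap, mul_xsqElem]
  simp only [map_sub, map_sum, bosFT_postcompCLM, toCLM_apply, bosFT_lineDeriv, smul_smul, hc]
  simp only [fermFTL_lapFL hr, map_smul, ← Finset.sum_smul, Finset.sum_neg_distrib]
  module

theorem superLap_superFT {r : ℝ} (hr : (r : ℂ) = 1 ∨ (r : ℂ) = -1)
    (G : 𝓢(Fin m → ℝ, Gr ℂ (2 * n))) (y : Fin m → ℝ) :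
    superFT m n r (fun x => Gr.mul (xsqElem m n x) (G x)) y =
      -superLap m n (superFT m n r G) y := by
  have hr2 : (r : ℂ) ^ 2 = 1 := by rcases hr with h | h <;> simp [h]
  rw [mul_xsqElem_schwartzMap, superLap]
  simp only [bderiv_bderiv_superFT hr2]
  simp only [superFT_schwartzMap, map_neg, map_sub, map_sum, bosFT_postcompCLM, toCLM_apply,
    ← lapFL_apply, map_smul, lapFL_fermFTL hr, smul_sub, Finset.smul_sum, smul_neg,
    Finset.sum_neg_distrib]
  abel

end Super

end

/-- For every `g ∈ S(ℝ^m)_{m|2n}` (sign `σ = ±1`):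
`F^±_{m|2n}(Δ g)(y) = -y² F^±_{m|2n}(g)(y)` and
`F^±_{m|2n}(x² g)(y) = -Δ_y F^±_{m|2n}(g)(y)`, where `x²` (resp. `y²`) denotes
multiplication by `Σ_j x`_{2j-1} x`_{2j} - Σ_j x_j²` and `Δ` is the super Laplace
operator. -/
theorem superFT_laplace (m n : ℕ) (hm : 1 ≤ m) (σ : ℂ) (hσ : σ = 1 ∨ σ = -1)
    (g : SF m n) (hg : IsSchwartz m n g) :
    superFT m n σ (superLap m n g) =
      (fun y => -(Gr.mul (xsqElem m n y) (superFT m n σ g y))) ∧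
    superFT m n σ (fun x => Gr.mul (xsqElem m n x) (g x)) =
      (fun y => -(superLap m n (superFT m n σ g) y)) := by
  obtain ⟨G, rfl⟩ := hg.exists_schwartzMap
  obtain ⟨r, rfl⟩ : ∃ r : ℝ, σ = r := by
    rcases hσ with rfl | rfl
    · exact ⟨1, by simp⟩
    · exact ⟨-1, by simp⟩
  exact ⟨funext (superFT_superLap hσ G), funext (superLap_superFT hσ G)⟩
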